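/- arXiv:2007.10266 — 2 statements merged into one kernel-verified Lean document; each statement's English description precedes it below -/
import Mathlib

section
/- Let a, b : ℝ → ℂ be continuous functions such that a(x) and b(x) each converge, as x → +∞ and as x → −∞, to a single common limit a(∞) resp. b(∞) (i.e., a and b extend continuously to the one-point compactification ℝ ∪ {∞}). Then the commutator [a·, W⁰(b)] := a·W⁰(b) − W⁰(b)∘(a·) is a compact operator on L²(ℝ), where W⁰(b) := F⁻¹ M_b F. -/
open MeasureTheory Filter Topology

/-- The Hilbert space `L²(ℝ)`. -/
noncomputable abbrev L2R := Lp ℂ 2 (volume : Measure ℝ)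

/-- Integral formula characterizing the Fourier transform on `L¹ ∩ L²`. -/
def IsFT (F : L2R →L[ℂ] L2R) : Prop :=
  ∀ f : L2R, Integrable (f : ℝ → ℂ) → (F f : ℝ → ℂ) =ᵐ[volume]
        fun x : ℝ => ∫ t : ℝ, f t * Complex.exp (Complex.I * (t : ℂ) * (x : ℂ))

/-- `A` is multiplication by `u`. -/
def IsMul (u : ℝ → ℂ) (A : L2R →L[ℂ] L2R) : Prop :=
  ∀ f : L2R, (A f : ℝ → ℂ) =ᵐ[volume] fun x => u x * f x

lemma integrable_mul_L2 {v : ℝ → ℂ} (hv : MemLp v 2 volume) (f : L2R) :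
    Integrable (fun t => v t * f t) volume :=
  MemLp.integrable_mul hv (Lp.memLp f)

lemma integral_norm_mul_le {v : ℝ → ℂ} (hv : MemLp v 2 volume) (f : L2R) :
    ∫ t, ‖v t‖ * ‖f t‖ ≤ ‖hv.toLp v‖ * ‖f‖ := by
  have h := (ContinuousLinearMap.mul ℂ ℂ).norm_holder_apply_apply_le (r := 1) (hv.toLp v) f
  have h1 : ‖ContinuousLinearMap.mul ℂ ℂ‖ = 1 := by simp
  rw [h1, one_mul, L1.norm_eq_integral_norm] at h
  refine le_trans (le_of_eq ?_) h
  refine integral_congr_ae ?_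
  filter_upwards [(ContinuousLinearMap.mul ℂ ℂ).coeFn_holder (r := 1) (hv.toLp v) f,
    hv.coeFn_toLp] with t h1 h2
  rw [h1]
  simp [h2]

lemma memLp_pow_mul {u : ℝ → ℂ} (hu : MemLp u 2 volume) {R : ℝ}
    (hu0 : ∀ x, R < |x| → u x = 0) (n : ℕ) (c : ℂ) :
    MemLp (fun x : ℝ => c * (x : ℂ) ^ n * u x) 2 volume := by
  refine MemLp.of_le_mul (c := ‖c‖ * R ^ n) hu ?_ ?_
  · have : Continuous (fun x : ℝ => c * (x : ℂ) ^ n) := by fun_prop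
    exact this.aestronglyMeasurable.mul hu.1
  · refine Eventually.of_forall fun x => ?_
    by_cases hx : R < |x|
    · simp [hu0 x hx]
    · push Not at hx
      simp only [norm_mul, norm_pow, Complex.norm_real, Real.norm_eq_abs]
      gcongr

lemma isCompactOperator_rankOne (W U : L2R) :
    IsCompactOperator ((innerSL ℂ W).smulRight U : L2R →L[ℂ] L2R) := by
  have h := (isCompactOperator_of_locallyCompactSpace_dom (innerSL ℂ W : L2R →L[ℂ] ℂ)).clm_comp
    (ContinuousLinearMap.toSpanSingleton ℂ U)
  exact h

lemma core (F : L2R →L[ℂ] L2R) (hF : IsFT F) (R : ℝ) (hR : 0 ≤ R)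
    (A B : L2R →L[ℂ] L2R) (u v : ℝ → ℂ) (hu : MemLp u 2 volume) (hv : MemLp v 2 volume)
    (hu0 : ∀ x, R < |x| → u x = 0) (hv0 : ∀ x, R < |x| → v x = 0)
    (hA : IsMul u A) (hB : IsMul v B) : IsCompactOperator (A.comp (F.comp B)) := by
  have hU : ∀ n : ℕ, MemLp (fun x : ℝ => Complex.I ^ n / n.factorial * (x : ℂ) ^ n * u x) 2 volume :=
    fun n => memLp_pow_mul hu hu0 n _
  have hW' : ∀ n : ℕ, MemLp (fun x : ℝ => 1 * (x : ℂ) ^ n * v x) 2 volume :=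
    fun n => memLp_pow_mul hv hv0 n _
  have hW : ∀ n : ℕ, MemLp (fun x : ℝ => (starRingEnd ℂ) (1 * (x : ℂ) ^ n * v x)) 2 volume :=
    fun n => (hW' n).star
  let K : ℕ → (L2R →L[ℂ] L2R) := fun N => ∑ n ∈ Finset.range N,
    (innerSL ℂ ((hW n).toLp _)).smulRight ((hU n).toLp _)
  have hK : ∀ N, IsCompactOperator (K N) := by
    intro N
    have : K N ∈ compactOperator (RingHom.id ℂ) L2R L2R :=
      Submodule.sum_mem _ fun n _ => isCompactOperator_rankOne _ _
    exact this
  have hKf : ∀ N (f : L2R), (K N f : ℝ → ℂ) =ᵐ[volume] fun x : ℝ =>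
      u x * ∫ t : ℝ, v t * f t * ∑ n ∈ Finset.range N,
        (Complex.I * (t : ℂ) * (x : ℂ)) ^ n / n.factorial := by
    intro N f
    have e1 : ∀ n, (innerSL ℂ ((hW n).toLp _)) f = ∫ t : ℝ, (v t * f t) * (t : ℂ) ^ n := by
      intro n
      rw [innerSL_apply_apply, L2.inner_def]
      refine integral_congr_ae ?_
      filter_upwards [(hW n).coeFn_toLp] with t ht
      rw [ht]
      simp only [RCLike.inner_apply, RingHomCompTriple.comp_apply, RingHom.id_apply, one_mul]
      ring
    have e2 : K N f = ∑ n ∈ Finset.range N, (∫ t : ℝ, (v t * f t) * (t : ℂ) ^ n) • (hU n).toLp _ := by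
      simp only [K, _root_.sum_apply, ContinuousLinearMap.smulRight_apply, e1]
    rw [e2]
    have e3 : ∀ᵐ x ∂(volume : Measure ℝ), ∀ n : ℕ,
        ((∫ t : ℝ, (v t * f t) * (t : ℂ) ^ n) • (hU n).toLp _ : L2R) x =
          (∫ t : ℝ, (v t * f t) * (t : ℂ) ^ n) *
            (Complex.I ^ n / n.factorial * (x : ℂ) ^ n * u x) := by
      rw [ae_all_iff]
      intro n
      filter_upwards [(hU n).coeFn_toLp, Lp.coeFn_smul (∫ t : ℝ, (v t * f t) * (t : ℂ) ^ n)
        ((hU n).toLp _)] with x h1 h2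
      rw [h2, Pi.smul_apply, h1, smul_eq_mul]
    filter_upwards [e3, Lp.coeFn_fun_finsetSum (Finset.range N) (fun n =>
      ((∫ t : ℝ, (v t * f t) * (t : ℂ) ^ n) • (hU n).toLp _ : L2R))] with x h1 h2
    rw [h2]
    simp only [h1, Finset.mul_sum]
    rw [integral_finsetSum, Finset.mul_sum]
    · refine Finset.sum_congr rfl fun n _ => ?_
      rw [← integral_mul_const, ← integral_const_mul]
      congr 1
      ext t
      ring
    · intro n _
      have := (integrable_mul_L2 (hW' n) f).mul_const ((Complex.I * x) ^ n / n.factorial)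
      refine this.congr (Eventually.of_forall fun t => ?_)
      simp only
      ring
  have hT : ∀ (f : L2R), ((A.comp (F.comp B)) f : ℝ → ℂ) =ᵐ[volume] fun x : ℝ =>
      u x * ∫ t : ℝ, v t * f t * Complex.exp (Complex.I * (t : ℂ) * (x : ℂ)) := by
    intro f
    have hi : Integrable (B f : ℝ → ℂ) := (integrable_mul_L2 hv f).congr (hB f).symm
    filter_upwards [hA (F (B f)), hF (B f) hi] with x h1 h2
    simp only [ContinuousLinearMap.comp_apply]
    rw [h1, h2]
    congr 1
    refine integral_congr_ae ?_
    filter_upwards [hB f] with t ht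
    rw [ht]
  let δ : ℕ → ℝ := fun N => (R * R) ^ N / N.factorial * 2
  have hexp : ∀ N : ℕ, 2 * (R * R) ≤ N → ∀ x t : ℝ, |x| ≤ R → |t| ≤ R →
      ‖Complex.exp (Complex.I * (t : ℂ) * (x : ℂ)) - ∑ n ∈ Finset.range N,
        (Complex.I * (t : ℂ) * (x : ℂ)) ^ n / n.factorial‖ ≤ δ N := by
    intro N hN x t hx ht
    have hz : ‖Complex.I * (t : ℂ) * (x : ℂ)‖ ≤ R * R := by
      simp only [norm_mul, Complex.norm_I, one_mul, Complex.norm_real, Real.norm_eq_abs]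
      gcongr
    refine (Complex.exp_bound' ?_).trans ?_
    · rw [div_le_iff₀ (by positivity)]
      push_cast
      linarith
    · simp only [δ]
      gcongr
  have hbound : ∀ N : ℕ, 2 * (R * R) ≤ N →
      ‖K N - A.comp (F.comp B)‖ ≤ δ N * ‖hv.toLp v‖ * ‖hu.toLp u‖ := by
    intro N hN
    have hδ : 0 ≤ δ N := by simp only [δ]; positivity
    refine ContinuousLinearMap.opNorm_le_bound _ (by positivity) fun f => ?_
    have key : ‖(K N - A.comp (F.comp B)) f‖ ≤ (δ N * (‖hv.toLp v‖ * ‖f‖)) * ‖hu.toLp u‖ := by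
      refine Lp.norm_le_mul_norm_of_ae_le_mul ?_
      rw [_root_.sub_apply]
      filter_upwards [hKf N f, hT f, hu.coeFn_toLp, Lp.coeFn_sub (K N f) ((A.comp (F.comp B)) f)]
        with x h1 h2 h3 h4
      rw [h4, Pi.sub_apply, h1, h2, h3, ← mul_sub, norm_mul, mul_comm]
      by_cases hx : R < |x|
      · simp [hu0 x hx]
      push Not at hx
      refine mul_le_mul_of_nonneg_right ?_ (norm_nonneg _)
      have hint := integrable_mul_L2 hv f
      have hi1 : Integrable (fun t : ℝ => v t * f t * ∑ n ∈ Finset.range N,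
          (Complex.I * (t : ℂ) * (x : ℂ)) ^ n / n.factorial) volume := by
        simp only [Finset.mul_sum]
        refine integrable_finsetSum _ fun n _ => ?_
        have := (integrable_mul_L2 (hW' n) f).mul_const ((Complex.I * x) ^ n / n.factorial)
        refine this.congr (Eventually.of_forall fun t => ?_)
        simp only
        ring
      have hi2 : Integrable (fun t : ℝ => v t * f t *
          Complex.exp (Complex.I * (t : ℂ) * (x : ℂ))) volume := by
        refine hint.mul_bdd (c := 1) ?_ ?_
        · exact (by fun_prop : Continuous fun t : ℝ =>
            Complex.exp (Complex.I * (t : ℂ) * (x : ℂ))).aestronglyMeasurable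
        · refine Eventually.of_forall fun t => le_of_eq ?_
          rw [show Complex.I * (t : ℂ) * (x : ℂ) = ((t * x : ℝ) : ℂ) * Complex.I by
            push_cast; ring]
          exact Complex.norm_exp_ofReal_mul_I _
      rw [← integral_sub hi1 hi2]
      have hn : Integrable (fun t => δ N * (‖v t‖ * ‖f t‖)) volume := by
        refine Integrable.const_mul ?_ _
        simpa only [norm_mul] using hint.norm
      refine (norm_integral_le_of_norm_le hn (Eventually.of_forall fun t => ?_)).trans ?_
      · rw [← mul_sub, norm_mul, norm_mul, mul_comm (δ N)]
        by_cases ht : R < |t|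
        · simp [hv0 t ht]
        push Not at ht
        refine mul_le_mul_of_nonneg_left ?_ (by positivity)
        rw [norm_sub_rev]
        exact hexp N hN x t hx ht
      · rw [integral_const_mul]
        exact mul_le_mul_of_nonneg_left (integral_norm_mul_le hv f) hδ
    calc _ ≤ _ := key
      _ = _ := by ring
  refine isCompactOperator_of_tendsto (l := atTop) (F := K) ?_ (Eventually.of_forall hK)
  rw [tendsto_iff_norm_sub_tendsto_zero]
  have hlim : Tendsto (fun N => δ N * ‖hv.toLp v‖ * ‖hu.toLp u‖) atTop (𝓝 0) := by
    have := (((FloorSemiring.tendsto_pow_div_factorial_atTop (R * R)).mul_const 2).mul_const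
      ‖hv.toLp v‖).mul_const ‖hu.toLp u‖
    simpa [δ] using this
  refine squeeze_zero' (Eventually.of_forall fun _ => norm_nonneg _) ?_ hlim
  filter_upwards [eventually_ge_atTop ⌈2 * (R * R)⌉₊] with N hN
  exact hbound N ((Nat.le_ceil _).trans (by exact_mod_cast hN))

lemma IsMul.norm_le {w : ℝ → ℂ} {T : L2R →L[ℂ] L2R} (hT : IsMul w T) {ε : ℝ} (hε : 0 ≤ ε)
    (hw : ∀ x, ‖w x‖ ≤ ε) : ‖T‖ ≤ ε := by
  refine ContinuousLinearMap.opNorm_le_bound _ hε fun f => ?_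
  refine Lp.norm_le_mul_norm_of_ae_le_mul ?_
  filter_upwards [hT f] with x hx
  rw [hx, norm_mul]
  exact mul_le_mul_of_nonneg_right (hw x) (norm_nonneg _)

lemma IsMul.sub {u v : ℝ → ℂ} {A B : L2R →L[ℂ] L2R} (hA : IsMul u A) (hB : IsMul v B) :
    IsMul (fun x => u x - v x) (A - B) := by
  intro f
  filter_upwards [hA f, hB f, Lp.coeFn_sub (A f) (B f)] with x h1 h2 h3
  change ((A f - B f : L2R) : ℝ → ℂ) x = _
  rw [h3, Pi.sub_apply, h1, h2, sub_mul]

lemma IsMul.comp {u v : ℝ → ℂ} {A B : L2R →L[ℂ] L2R} (hA : IsMul u A) (hB : IsMul v B) :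
    IsMul (fun x => u x * v x) (A.comp B) := by
  intro f
  filter_upwards [hA (B f), hB f] with x h1 h2
  simp only [ContinuousLinearMap.comp_apply]
  rw [h1, h2, mul_assoc]

lemma isMul_const (c : ℂ) : IsMul (fun _ => c) (c • ContinuousLinearMap.id ℂ L2R) := by
  intro f
  filter_upwards [Lp.coeFn_smul c f] with x h
  change ((c • f : L2R) : ℝ → ℂ) x = _
  rw [h, Pi.smul_apply, smul_eq_mul]

/-- Cut-off function. -/
noncomputable def cut (n : ℕ) : ℝ → ℂ := Set.indicator (Set.Icc (-(n : ℝ)) n) 1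

lemma cut_of_le {n : ℕ} {x : ℝ} (h : |x| ≤ n) : cut n x = 1 := by
  rw [cut, Set.indicator_of_mem]
  · rfl
  · exact abs_le.1 h

lemma cut_of_lt {n : ℕ} {x : ℝ} (h : (n : ℝ) < |x|) : cut n x = 0 := by
  rw [cut, Set.indicator_of_notMem]
  intro hx
  exact absurd (abs_le.2 hx) (not_le.2 h)

lemma measurable_cut (n : ℕ) : Measurable (cut n) :=
  measurable_one.indicator measurableSet_Icc

lemma memLp_cut (n : ℕ) (p : ENNReal) : MemLp (cut n) p volume := by
  refine memLp_indicator_const p measurableSet_Icc (1 : ℂ) (Or.inr ?_)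
  simp

lemma exists_cut_op (n : ℕ) : ∃ P : L2R →L[ℂ] L2R, IsMul (cut n) P := by
  refine ⟨(ContinuousLinearMap.mul ℂ ℂ).holderL volume ⊤ 2 2 ((memLp_cut n ⊤).toLp _), fun f => ?_⟩
  filter_upwards [(ContinuousLinearMap.mul ℂ ℂ).coeFn_holder (r := 2) ((memLp_cut n ⊤).toLp _) f,
    (memLp_cut n ⊤).coeFn_toLp] with t h1 h2
  rw [ContinuousLinearMap.holderL_apply_apply, h1, h2]
  simp

lemma exists_bound {a : ℝ → ℂ} (ha : Continuous a) (h0 : Tendsto a (cocompact ℝ) (𝓝 0)) :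
    ∃ C, ∀ x, ‖a x‖ ≤ C := by
  let g : ZeroAtInftyContinuousMap ℝ ℂ := ⟨⟨a, ha⟩, h0⟩
  exact ⟨‖g.toBCF‖, fun x => g.toBCF.norm_coe_le_norm x⟩

lemma memLp_cut_mul {a : ℝ → ℂ} (ha : Continuous a) (h0 : Tendsto a (cocompact ℝ) (𝓝 0)) (n : ℕ) :
    MemLp (fun x => cut n x * a x) 2 volume := by
  obtain ⟨C, hC⟩ := exists_bound ha h0
  refine MemLp.of_le_mul (c := C) (memLp_cut n 2)
    ((measurable_cut n).aestronglyMeasurable.mul ha.aestronglyMeasurable) ?_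
  refine Eventually.of_forall fun x => ?_
  rw [norm_mul, mul_comm]
  exact mul_le_mul_of_nonneg_right (hC x) (norm_nonneg _)

lemma tendsto_cut {a : ℝ → ℂ} (h0 : Tendsto a (cocompact ℝ) (𝓝 0))
    {T : L2R →L[ℂ] L2R} {S : ℕ → L2R →L[ℂ] L2R} (hT : IsMul a T)
    (hS : ∀ n, IsMul (fun x => cut n x * a x) (S n)) : Tendsto S atTop (𝓝 T) := by
  rw [tendsto_iff_norm_sub_tendsto_zero, Metric.tendsto_atTop]
  intro ε hε
  have h1 : ∀ᶠ x in cocompact ℝ, ‖a x‖ < ε / 2 := by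
    have := h0.norm
    rw [norm_zero] at this
    exact this.eventually (gt_mem_nhds (by positivity))
  rw [← Metric.cobounded_eq_cocompact, (Metric.hasBasis_cobounded_compl_closedBall (0 : ℝ)).eventually_iff] at h1
  obtain ⟨r, -, hr⟩ := h1
  refine ⟨⌈r⌉₊, fun n hn => ?_⟩
  have hrn : r ≤ n := (Nat.le_ceil _).trans (by exact_mod_cast hn)
  have : ‖S n - T‖ ≤ ε / 2 := by
    refine ((hS n).sub hT).norm_le (by positivity) fun x => ?_
    rcases le_or_gt |x| n with hx | hx
    · rw [cut_of_le hx]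
      simp
      positivity
    · rw [cut_of_lt hx, zero_mul, zero_sub, norm_neg]
      refine (hr ?_).le
      simp
      linarith
  rw [dist_zero_right, norm_norm]
  linarith

lemma compact_C0 (F : L2R →L[ℂ] L2R) (hF : IsFT F) (A B : L2R →L[ℂ] L2R) (u v : ℝ → ℂ)
    (hu : Continuous u) (hv : Continuous v) (hu0 : Tendsto u (cocompact ℝ) (𝓝 0))
    (hv0 : Tendsto v (cocompact ℝ) (𝓝 0))
    (hA : IsMul u A) (hB : IsMul v B) : IsCompactOperator (A.comp (F.comp B)) := by
  choose P hP using exists_cut_op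
  have hA' := tendsto_cut hu0 hA (fun n => (hP n).comp hA)
  have hB' := tendsto_cut hv0 hB (fun n => (hP n).comp hB)
  have hlim : Tendsto (fun n => ((P n).comp A).comp (F.comp ((P n).comp B))) atTop
      (𝓝 (A.comp (F.comp B))) :=
    hA'.mul ((tendsto_const_nhds (x := F)).mul hB')
  refine isCompactOperator_of_tendsto hlim (Eventually.of_forall fun n => ?_)
  exact core F hF n (Nat.cast_nonneg n) _ _ _ _ (memLp_cut_mul hu hu0 n) (memLp_cut_mul hv hv0 n)
    (fun x hx => by rw [cut_of_lt hx, zero_mul]) (fun x hx => by rw [cut_of_lt hx, zero_mul])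
    ((hP n).comp hA) ((hP n).comp hB)

lemma mp_neg : MeasurePreserving (fun x : ℝ => -x) volume volume :=
  Measure.measurePreserving_neg volume

/-- Reflection. -/
noncomputable def refl2 : L2R →L[ℂ] L2R :=
  (Lp.compMeasurePreservingₗᵢ ℂ (fun x : ℝ => -x) mp_neg).toContinuousLinearMap

lemma refl2_ae (f : L2R) : (refl2 f : ℝ → ℂ) =ᵐ[volume] fun x => f (-x) :=
  Lp.coeFn_compMeasurePreserving f mp_neg

open FourierTransform in
lemma F_refl_F (F : L2R →L[ℂ] L2R) (hF : IsFT F) (f : L2R) :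
    F (refl2 (F f)) = (2 * Real.pi : ℂ) • f := by
  have hcont1 : Continuous fun f => F (refl2 (F f)) :=
    F.continuous.comp (refl2.continuous.comp F.continuous)
  have hcont2 : Continuous fun f : L2R => (2 * Real.pi : ℂ) • f := continuous_const_smul _
  refine congrFun ((SchwartzMap.denseRange_toLpCLM (E := ℝ) (F := ℂ) (p := 2) (μ := volume)
    ENNReal.ofNat_ne_top).equalizer hcont1 hcont2 ?_) f
  ext1 φ
  simp only [Function.comp_apply, SchwartzMap.toLpCLM_apply]
  have hφ := φ.coeFn_toLp 2 volume
  have hφi : Integrable (φ.toLp 2 volume : ℝ → ℂ) := φ.integrable.congr hφ.symm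
  have h1 : (F (φ.toLp 2 volume) : ℝ → ℂ) =ᵐ[volume]
      fun x : ℝ => (𝓕 φ : SchwartzMap ℝ ℂ) (-x / (2 * Real.pi)) := by
    filter_upwards [hF _ hφi] with x hx
    rw [hx, SchwartzMap.fourier_coe, Real.fourier_real_eq_integral_exp_smul]
    refine integral_congr_ae ?_
    filter_upwards [hφ] with t ht
    rw [ht, smul_eq_mul, mul_comm]
    congr 2
    have : (Real.pi : ℂ) ≠ 0 := by exact_mod_cast Real.pi_ne_zero
    push_cast
    field_simp
  have h2 : (refl2 (F (φ.toLp 2 volume)) : ℝ → ℂ) =ᵐ[volume]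
      fun x : ℝ => (𝓕 φ : SchwartzMap ℝ ℂ) (x / (2 * Real.pi)) := by
    filter_upwards [refl2_ae (F (φ.toLp 2 volume)), mp_neg.quasiMeasurePreserving.ae h1] with x h3 h4
    rw [h3, h4, neg_neg]
  have hi : Integrable (refl2 (F (φ.toLp 2 volume)) : ℝ → ℂ) := by
    refine Integrable.congr ?_ h2.symm
    exact (𝓕 φ : SchwartzMap ℝ ℂ).integrable.comp_div (by positivity)
  refine Lp.ext ?_
  filter_upwards [hF _ hi, Lp.coeFn_smul (2 * Real.pi : ℂ) (φ.toLp 2 volume), hφ] with y h3 h4 h5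
  rw [h3, h4, Pi.smul_apply, h5]
  have h6 : ∫ t : ℝ, (refl2 (F (φ.toLp 2 volume)) : ℝ → ℂ) t *
      Complex.exp (Complex.I * (t : ℂ) * (y : ℂ)) =
      ∫ t : ℝ, (fun s : ℝ => (𝓕 φ : SchwartzMap ℝ ℂ) s * Complex.exp (((2 * Real.pi * (s * y) : ℝ) : ℂ) * Complex.I))
        (t / (2 * Real.pi)) := by
    refine integral_congr_ae ?_
    filter_upwards [h2] with t ht
    rw [ht]
    congr 2
    have : (Real.pi : ℂ) ≠ 0 := by exact_mod_cast Real.pi_ne_zero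
    push_cast
    field_simp
  rw [h6, Measure.integral_comp_div (fun s : ℝ => (𝓕 φ : SchwartzMap ℝ ℂ) s *
    Complex.exp (((2 * Real.pi * (s * y) : ℝ) : ℂ) * Complex.I)) (2 * Real.pi), abs_of_pos (by positivity)]
  have h7 : 𝓕⁻ (𝓕 (φ : ℝ → ℂ)) = φ := Continuous.fourierInv_fourier_eq φ.continuous φ.integrable
    (𝓕 φ : SchwartzMap ℝ ℂ).integrable
  have h8 := congrFun h7 y
  rw [Real.fourierInv_eq'] at h8
  rw [← h8, Complex.real_smul, smul_eq_mul]
  push_cast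
  congr 2
  ext s
  simp only [SchwartzMap.fourier_coe, smul_eq_mul]
  rw [mul_comm]
  congr 2
  simp
  ring

lemma refl_mul {u : ℝ → ℂ} {A : L2R →L[ℂ] L2R} (hA : IsMul u A) :
    IsMul (fun x => u (-x)) (refl2.comp (A.comp refl2)) := by
  intro f
  have e1 := mp_neg.quasiMeasurePreserving.ae (hA (refl2 f))
  have e2 := mp_neg.quasiMeasurePreserving.ae (refl2_ae f)
  filter_upwards [refl2_ae (A (refl2 f)), e1, e2] with x h1 h2 h3
  simp only [ContinuousLinearMap.comp_apply]
  rw [h1, h2, h3, neg_neg]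

lemma refl_refl (f : L2R) : refl2 (refl2 f) = f := by
  refine Lp.ext ?_
  filter_upwards [refl2_ae (refl2 f), mp_neg.quasiMeasurePreserving.ae (refl2_ae f)] with x h1 h2
  rw [h1, h2, neg_neg]

lemma symm_eq (F : L2R ≃L[ℂ] L2R) (hF : IsFT (F : L2R →L[ℂ] L2R)) (f : L2R) :
    F.symm f = (2 * Real.pi : ℂ)⁻¹ • refl2 (F f) := by
  have hpi : (2 * Real.pi : ℂ) ≠ 0 := by
    have : (Real.pi : ℂ) ≠ 0 := by exact_mod_cast Real.pi_ne_zero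
    simp [this]
  rw [ContinuousLinearEquiv.symm_apply_eq, map_smul]
  have := F_refl_F _ hF f
  simp only [ContinuousLinearEquiv.coe_coe] at this
  rw [this, smul_smul, inv_mul_cancel₀ hpi, one_smul]

lemma compact_C0_symm (F : L2R ≃L[ℂ] L2R) (hF : IsFT (F : L2R →L[ℂ] L2R))
    (A B : L2R →L[ℂ] L2R) (u v : ℝ → ℂ)
    (hu : Continuous u) (hv : Continuous v) (hu0 : Tendsto u (cocompact ℝ) (𝓝 0))
    (hv0 : Tendsto v (cocompact ℝ) (𝓝 0))
    (hA : IsMul u A) (hB : IsMul v B) :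
    IsCompactOperator (A.comp ((F.symm : L2R →L[ℂ] L2R).comp B)) := by
  have h := compact_C0 F hF (refl2.comp (A.comp refl2)) B (fun x => u (-x)) v
    (hu.comp continuous_neg) hv
    (hu0.comp (Homeomorph.neg ℝ).isClosedEmbedding.tendsto_cocompact) hv0 (refl_mul hA) hB
  have h' := (h.clm_comp refl2).smul ((2 * Real.pi : ℂ)⁻¹)
  refine (congrArg IsCompactOperator (funext fun f => ?_)).mpr h'
  simp [symm_eq F hF, refl_refl]

/-- If `a, b : ℝ → ℂ` are continuous and each converges to a single limit at `±∞`
(i.e. extends continuously to `ℝ ∪ {∞}`), `F` is the Fourier–Plancherel transform on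
`L²(ℝ)` and `Ma`, `Mb` are the multiplication operators by `a` resp. `b`, then the
commutator `[a·, W⁰(b)] = Ma ∘ W⁰(b) - W⁰(b) ∘ Ma` with `W⁰(b) = F⁻¹ ∘ Mb ∘ F` is a
compact operator on `L²(ℝ)`. -/
theorem stmt8
    (a b : ℝ → ℂ) (ha : Continuous a) (hb : Continuous b)
    (ha_inf : ∃ ca : ℂ, Tendsto a (cocompact ℝ) (nhds ca))
    (hb_inf : ∃ cb : ℂ, Tendsto b (cocompact ℝ) (nhds cb))
    (F : Lp ℂ 2 (volume : Measure ℝ) ≃L[ℂ] Lp ℂ 2 (volume : Measure ℝ))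
    (hF : ∀ f : Lp ℂ 2 (volume : Measure ℝ), Integrable (f : ℝ → ℂ) →
      (F f : ℝ → ℂ) =ᵐ[volume]
        fun x : ℝ => ∫ t : ℝ, f t * Complex.exp (Complex.I * (t : ℂ) * (x : ℂ)))
    (Ma Mb : Lp ℂ 2 (volume : Measure ℝ) →L[ℂ] Lp ℂ 2 (volume : Measure ℝ))
    (hMa : ∀ f : Lp ℂ 2 (volume : Measure ℝ),
      (Ma f : ℝ → ℂ) =ᵐ[volume] fun x => a x * f x)
    (hMb : ∀ f : Lp ℂ 2 (volume : Measure ℝ),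
      (Mb f : ℝ → ℂ) =ᵐ[volume] fun x => b x * f x) :
    IsCompactOperator
      (Ma.comp ((F.symm : Lp ℂ 2 (volume : Measure ℝ) →L[ℂ] Lp ℂ 2 (volume : Measure ℝ)).comp
          (Mb.comp (F : Lp ℂ 2 (volume : Measure ℝ) →L[ℂ] Lp ℂ 2 (volume : Measure ℝ)))) -
        ((F.symm : Lp ℂ 2 (volume : Measure ℝ) →L[ℂ] Lp ℂ 2 (volume : Measure ℝ)).comp
          (Mb.comp (F : Lp ℂ 2 (volume : Measure ℝ) →L[ℂ] Lp ℂ 2 (volume : Measure ℝ)))).comp Ma) := by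
  obtain ⟨ca, hca⟩ := ha_inf
  obtain ⟨cb, hcb⟩ := hb_inf
  have hF' : IsFT (F : L2R →L[ℂ] L2R) := hF
  have hA : IsMul (fun x => a x - ca) (Ma - ca • ContinuousLinearMap.id ℂ L2R) :=
    IsMul.sub hMa (isMul_const ca)
  have hB : IsMul (fun x => b x - cb) (Mb - cb • ContinuousLinearMap.id ℂ L2R) :=
    IsMul.sub hMb (isMul_const cb)
  have ha' : Continuous fun x => a x - ca := ha.sub continuous_const
  have hb' : Continuous fun x => b x - cb := hb.sub continuous_const
  have ha0 : Tendsto (fun x => a x - ca) (cocompact ℝ) (𝓝 0) := by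
    simpa using hca.sub_const ca
  have hb0 : Tendsto (fun x => b x - cb) (cocompact ℝ) (𝓝 0) := by
    simpa using hcb.sub_const cb
  have k1 := (compact_C0_symm F hF' _ _ _ _ ha' hb' ha0 hb0 hA hB).comp_clm (F : L2R →L[ℂ] L2R)
  have k2 := (compact_C0 F hF' _ _ _ _ hb' ha' hb0 ha0 hB hA).clm_comp (F.symm : L2R →L[ℂ] L2R)
  refine (congrArg IsCompactOperator (funext fun f => ?_)).mpr (k1.sub k2)
  simp [smul_sub, smul_comm cb ca f]
  abel
end

section
/- Let a ∈ C_c(ℝ) and let b ∈ C_c(ℝ) have bounded variation V(b) < ∞. For R > 0 let χ_{\{R\}} denote the characteristic function of ℝ ∖ [−R, R]. Then for every n ∈ ℕ ∪ {0} there exists a constant c_n(a,b) ∈ (0,∞), depending only on a, b and n, such that for all R > 0 the operator f ↦ a · W⁰(b)(χ_{\{R\}} f) on L²(ℝ) has operator norm at most c_n(a,b)/log^n(R+2), where W⁰(b) := F⁻¹ M_b F. -/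
open MeasureTheory Filter Topology

lemma cs_aux (f g : Lp ℂ 2 (volume : Measure ℝ)) :
    Integrable (fun t => ‖f t‖ * ‖g t‖) ∧ ∫ t, ‖f t‖ * ‖g t‖ ≤ ‖f‖ * ‖g‖ := by
  have hf := Lp.memLp f
  have hg := Lp.memLp g
  refine ⟨?_, ?_⟩
  · exact hf.norm.integrable_mul hg.norm
  · have h := integral_mul_norm_le_Lp_mul_Lq (μ := volume) (f := f) (g := g) (p := 2) (q := 2)
      Real.HolderConjugate.two_two (by simpa using hf) (by simpa using hg)
    have key : ∀ k : Lp ℂ 2 (volume : Measure ℝ), ‖k‖ = (∫ t, ‖k t‖ ^ (2:ℝ)) ^ (1 / (2:ℝ)) := by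
      intro k
      rw [Lp.norm_def, MemLp.eLpNorm_eq_integral_rpow_norm (by simp) (by simp) (Lp.memLp k),
        ENNReal.toReal_ofReal (by positivity)]
      simp
    rw [key f, key g]; exact h

lemma memLp_h : MemLp (fun t : ℝ => (((1 + ‖t‖) ^ (-(3/4) : ℝ) : ℝ) : ℂ)) 2 volume := by
  rw [memLp_two_iff_integrable_sq_norm]
  · have := integrable_one_add_norm (E := ℝ) (μ := volume) (r := 3/2) (by norm_num)
    refine this.congr (Eventually.of_forall fun t => ?_)
    simp only
    have : 0 < 1 + ‖t‖ := by positivity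
    rw [Complex.norm_real, Real.norm_of_nonneg (r := (1 + ‖t‖) ^ (-(3/4) : ℝ)) (by positivity), ← Real.rpow_natCast, ← Real.rpow_mul this.le]
    norm_num
  · apply Continuous.aestronglyMeasurable
    apply Complex.continuous_ofReal.comp
    apply Continuous.rpow_const (by fun_prop)
    intro x; left; positivity

open FourierTransform in
lemma parseval (F : Lp ℂ 2 (volume : Measure ℝ) ≃L[ℂ] Lp ℂ 2 (volume : Measure ℝ))
    (hF : ∀ f : Lp ℂ 2 (volume : Measure ℝ), Integrable (f : ℝ → ℂ) →
      (F f : ℝ → ℂ) =ᵐ[volume]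
        fun x : ℝ => ∫ t : ℝ, f t * Complex.exp (Complex.I * (t : ℂ) * (x : ℂ)))
    (f g : Lp ℂ 2 (volume : Measure ℝ)) :
    inner ℂ (F f) (F g) = 2 * Real.pi * inner ℂ f g := by
  have hS : ∀ u : SchwartzMap ℝ ℂ, (F (u.toLp 2) : ℝ → ℂ) =ᵐ[volume]
      fun x => (𝓕 u) ((-(2 * Real.pi)⁻¹) * x) := by
    intro u
    have hu := u.coeFn_toLp 2 volume
    have h1 := hF (u.toLp 2) (u.integrable.congr hu.symm)
    refine h1.trans (Eventually.of_forall fun x => ?_)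
    simp only [SchwartzMap.fourier_coe, Real.fourier_eq']
    apply integral_congr_ae
    filter_upwards [hu] with t ht
    rw [ht, smul_eq_mul, mul_comm]
    congr 2
    simp
    field_simp
  have hD := SchwartzMap.denseRange_toLpCLM (E := ℝ) (F := ℂ) (p := 2) (μ := volume) ENNReal.ofNat_ne_top
  refine hD.induction_on₂ (p := fun f g => inner ℂ (F f) (F g) = 2 * Real.pi * inner ℂ f g) ?_ ?_ f g
  · apply isClosed_eq <;> fun_prop
  · intro u v
    simp only [SchwartzMap.toLpCLM_apply]
    rw [SchwartzMap.inner_toL2_toL2_eq u v volume, ← SchwartzMap.integral_inner_fourier_fourier, L2.inner_def]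
    rw [integral_congr_ae (g := fun x => (fun y => inner ℂ ((𝓕 u) y) ((𝓕 v) y)) ((-(2 * Real.pi)⁻¹) * x))]
    · refine (Measure.integral_comp_mul_left (fun y : ℝ => (inner ℂ ((𝓕 u : SchwartzMap ℝ ℂ) y)
        ((𝓕 v : SchwartzMap ℝ ℂ) y) : ℂ)) (-(2 * Real.pi)⁻¹)).trans ?_
      simp [abs_of_pos Real.pi_pos]
    · filter_upwards [hS u, hS v] with x h1 h2
      rw [h1, h2]

lemma shift_bound (b : ℝ → ℂ) (hb : Continuous b) (hb_supp : HasCompactSupport b)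
    (hb_var : eVariationOn b Set.univ ≠ ⊤) (h : ℝ) (hh : 0 < h) :
    ∫ x, ‖b (x + h) - b x‖ ≤ h * (eVariationOn b Set.univ).toReal := by
  have hl : LocallyBoundedVariationOn b Set.univ := BoundedVariationOn.locallyBoundedVariationOn hb_var
  set v := variationOnFromTo b Set.univ 0 with hv
  have hmono : Monotone v := by
    rw [← monotoneOn_univ]
    exact variationOnFromTo.monotoneOn hl (Set.mem_univ _)
  have hle : ∀ x y, x ≤ y → ‖b y - b x‖ ≤ v y - v x := by
    intro x y hxy
    rw [hv, variationOnFromTo.sub_right hl (Set.mem_univ _) (Set.mem_univ _) (Set.mem_univ _),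
      variationOnFromTo.eq_of_le _ _ hxy, ← dist_eq_norm, dist_edist]
    apply ENNReal.toReal_mono (hl x y (Set.mem_univ _) (Set.mem_univ _))
    apply eVariationOn.edist_le
    exacts [⟨Set.mem_univ _, hxy, le_rfl⟩, ⟨Set.mem_univ _, le_rfl, hxy⟩]
  have hV : ∀ x y, x ≤ y → v y - v x ≤ (eVariationOn b Set.univ).toReal := by
    intro x y hxy
    rw [hv, variationOnFromTo.sub_right hl (Set.mem_univ _) (Set.mem_univ _) (Set.mem_univ _),
      variationOnFromTo.eq_of_le _ _ hxy]
    exact ENNReal.toReal_mono hb_var (eVariationOn.mono _ (Set.subset_univ _))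
  obtain ⟨B, hB⟩ := hb_supp.isCompact.isBounded.subset_closedBall 0
  have hz : ∀ x, B < |x| → b x = 0 := by
    intro x hx
    by_contra hne
    have := hB (subset_tsupport b hne)
    simp at this; linarith
  have hi : ∀ p q, IntervalIntegrable v volume p q := fun p q => hmono.intervalIntegrable
  have hi' : ∀ p q, IntervalIntegrable (fun x => v (x + h)) volume p q := fun p q =>
    Monotone.intervalIntegrable (fun x y hxy => hmono (by linarith))
  let p := -(|B|+h+1)
  let q := |B| + 1
  have hpq : p ≤ q := by simp only [p, q]; have := abs_nonneg B; linarith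
  have e1 : ∫ x, ‖b (x + h) - b x‖ = ∫ x in p..q, ‖b (x + h) - b x‖ := by
    rw [intervalIntegral.integral_of_le hpq, setIntegral_eq_integral_of_forall_compl_eq_zero]
    intro x hx
    have : x ≤ p ∨ q < x := by
      by_contra hc; push Not at hc; exact hx ⟨hc.1, hc.2⟩
    have hBa := le_abs_self B
    rw [hz x, hz (x+h)]; simp
    · rcases this with h1 | h1 <;> simp only [p, q] at h1
      · rw [abs_of_nonpos] <;> linarith [abs_nonneg B]
      · rw [abs_of_nonneg] <;> linarith [abs_nonneg B]
    · rcases this with h1 | h1 <;> simp only [p, q] at h1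
      · rw [abs_of_nonpos] <;> linarith [abs_nonneg B]
      · rw [abs_of_nonneg] <;> linarith [abs_nonneg B]
  rw [e1]
  calc _ ≤ ∫ x in p..q, (v (x + h) - v x) := by
        apply intervalIntegral.integral_mono_on hpq
        · apply Continuous.intervalIntegrable; fun_prop
        · exact (hi' _ _).sub (hi _ _)
        · intro x _; exact hle _ _ (by linarith)
    _ = (∫ x in q..q+h, v x) - ∫ x in p..p+h, v x := by
        rw [intervalIntegral.integral_sub (hi' _ _) (hi _ _), intervalIntegral.integral_comp_add_right]
        have h1 := intervalIntegral.integral_add_adjacent_intervals (hi p q) (hi q (q+h))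
        have h2 := intervalIntegral.integral_add_adjacent_intervals (hi p (p+h)) (hi (p+h) (q+h))
        rw [← h1] at h2
        linear_combination h2
    _ = ∫ x in p..p+h, (v (x + (q-p)) - v x) := by
        rw [intervalIntegral.integral_sub _ (hi _ _), intervalIntegral.integral_comp_add_right]
        · congr 2 <;> ring
        · exact Monotone.intervalIntegrable (fun x y hxy => hmono (by linarith))
    _ ≤ ∫ x in p..p+h, (eVariationOn b Set.univ).toReal := by
        apply intervalIntegral.integral_mono_on (by linarith)
        · exact (Monotone.intervalIntegrable (fun x y hxy => hmono (by linarith))).sub (hi _ _)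
        · simp
        · intro x _; exact hV _ _ (by linarith)
    _ = _ := by simp

/-- The kernel decays. -/
lemma kernel_decay (b : ℝ → ℂ) (hb : Continuous b) (hb_supp : HasCompactSupport b)
    (hb_var : eVariationOn b Set.univ ≠ ⊤) (s : ℝ) (hs : s ≠ 0) :
    ‖∫ y, b y * Complex.exp (Complex.I * s * y)‖ ≤ 2 * (eVariationOn b Set.univ).toReal / |s| * Real.pi := by
  set V := (eVariationOn b Set.univ).toReal
  have hint : Integrable b := hb.integrable_of_hasCompactSupport hb_supp
  have hne : ∀ y : ℝ, ‖Complex.exp (Complex.I * s * y)‖ = 1 := by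
    intro y
    rw [show Complex.I * s * y = ((s * y : ℝ) : ℂ) * Complex.I by push_cast; ring]
    exact Complex.norm_exp_ofReal_mul_I _
  have hmul : ∀ g : ℝ → ℂ, Integrable g → Integrable (fun y : ℝ => g y * Complex.exp (Complex.I * s * y)) := by
    intro g hg
    refine hg.mul_bdd (c := 1) (by fun_prop) (Eventually.of_forall fun y => (hne y).le)
  set h := Real.pi / |s|
  have hh : 0 < h := by have := Real.pi_pos; positivity
  have hexp : Complex.exp (Complex.I * s * h) = -1 := by
    rcases lt_or_gt_of_ne hs with h0 | h0
    · have : Complex.I * s * h = -(Real.pi * Complex.I) := by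
        simp only [h, abs_of_neg h0]; push_cast
        have : (s:ℂ) ≠ 0 := by exact_mod_cast hs
        field_simp
      rw [this, Complex.exp_neg, Complex.exp_pi_mul_I]; norm_num
    · have : Complex.I * s * h = (Real.pi * Complex.I) := by
        simp only [h, abs_of_pos h0]; push_cast
        have : (s:ℂ) ≠ 0 := by exact_mod_cast hs
        field_simp
      rw [this, Complex.exp_pi_mul_I]
  have hsh : ∫ y, b (y + h) * Complex.exp (Complex.I * s * y) = - ∫ y, b y * Complex.exp (Complex.I * s * y) := by
    rw [← integral_add_right_eq_self (fun y : ℝ => b y * Complex.exp (Complex.I * s * y)) h, ← integral_neg]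
    congr 1; ext y
    push_cast
    rw [mul_add, Complex.exp_add, hexp]; ring
  have e : ∫ y, (b (y+h) - b y) * Complex.exp (Complex.I * s * y) = - (2 * ∫ y, b y * Complex.exp (Complex.I * s * y)) := by
    simp_rw [sub_mul]
    rw [integral_sub (hmul _ (hint.comp_add_right h)) (hmul _ hint), hsh]; ring
  have h1 : ‖∫ y, (b (y+h) - b y) * Complex.exp (Complex.I * s * y)‖ ≤ h * V := by
    refine (norm_integral_le_integral_norm _).trans ?_
    simp_rw [norm_mul, hne, mul_one]
    exact shift_bound b hb hb_supp hb_var h hh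
  rw [e, norm_neg, norm_mul] at h1
  have hVn : 0 ≤ V := ENNReal.toReal_nonneg
  have e2 : 2 * V / |s| * Real.pi = 2 * (h * V) := by simp only [h]; ring
  rw [e2]
  have : 0 ≤ h * V := by positivity
  simp at h1
  linarith [norm_nonneg (∫ y, b y * Complex.exp (Complex.I * s * y))]

lemma norm_exp_aux (x y : ℝ) : ‖Complex.exp (Complex.I * x * y)‖ = 1 := by
  rw [show Complex.I * x * y = ((x * y : ℝ) : ℂ) * Complex.I by push_cast; ring]
  exact Complex.norm_exp_ofReal_mul_I _

lemma triple (b g ψ : ℝ → ℂ) (hb : Integrable b) (hg : Integrable g) (hψ : Integrable ψ) :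
    ∫ y : ℝ, b y * (∫ t : ℝ, g t * Complex.exp (Complex.I * t * y)) *
        (starRingEnd ℂ) (∫ x : ℝ, ψ x * Complex.exp (Complex.I * x * y)) =
      ∫ p : ℝ × ℝ, (g p.1 * (starRingEnd ℂ) (ψ p.2)) *
        ∫ y : ℝ, b y * Complex.exp (Complex.I * ((p.1 - p.2 : ℝ) : ℂ) * y) := by
  have hψ' : Integrable (fun x => (starRingEnd ℂ) (ψ x)) :=
    (Complex.conjCLE : ℂ →L[ℝ] ℂ).integrable_comp hψ
  have h1 : ∀ y : ℝ, b y * (∫ t : ℝ, g t * Complex.exp (Complex.I * t * y)) *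
        (starRingEnd ℂ) (∫ x : ℝ, ψ x * Complex.exp (Complex.I * x * y)) =
      ∫ p : ℝ × ℝ, (g p.1 * (starRingEnd ℂ) (ψ p.2)) *
        (b y * Complex.exp (Complex.I * ((p.1 - p.2 : ℝ) : ℂ) * y)) := by
    intro y
    rw [← integral_conj, mul_assoc, ← integral_prod_mul, ← integral_const_mul]
    congr 1; ext p
    rw [map_mul, ← Complex.exp_conj]
    have : Complex.exp (Complex.I * ((p.1 - p.2 : ℝ) : ℂ) * y) =
        Complex.exp (Complex.I * p.1 * y) *
          Complex.exp ((starRingEnd ℂ) (Complex.I * p.2 * y)) := by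
      rw [← Complex.exp_add]; congr 1
      simp; ring
    rw [this]; ring
  simp_rw [h1]
  rw [integral_integral_swap]
  · simp_rw [integral_const_mul]
  · have hi : Integrable (fun q : ℝ × ℝ × ℝ => b q.1 * (g q.2.1 * (starRingEnd ℂ) (ψ q.2.2)))
        (volume.prod (volume.prod volume)) := hb.mul_prod (hg.mul_prod hψ')
    have h2 := hi.mul_bdd (c := 1)
      (g := fun q : ℝ × ℝ × ℝ => Complex.exp (Complex.I * ((q.2.1 - q.2.2 : ℝ) : ℂ) * q.1))
      (Continuous.aestronglyMeasurable (by fun_prop))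
      (Eventually.of_forall fun q => (norm_exp_aux _ _).le)
    refine h2.congr (Eventually.of_forall fun q => ?_)
    simp only [Function.uncurry]
    ring

lemma inv_aux (R t : ℝ) (hR : 1 ≤ R) (ht : R < |t|) :
    |t|⁻¹ ≤ 3 * (R + 2) ^ (-(1/4) : ℝ) * (1 + ‖t‖) ^ (-(3/4) : ℝ) := by
  rw [Real.norm_eq_abs]
  have h0 : 0 < |t| := by linarith
  have h1 : |t|⁻¹ ≤ 3 * (|t| + 2) ^ (-1 : ℝ) := by
    rw [Real.rpow_neg_one, ← div_eq_mul_inv, inv_eq_one_div, div_le_div_iff₀ h0 (by linarith)]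
    linarith
  have h2 : (|t| + 2) ^ (-1 : ℝ) = (|t| + 2) ^ (-(1/4) : ℝ) * (|t| + 2) ^ (-(3/4) : ℝ) := by
    rw [← Real.rpow_add (by linarith)]; norm_num
  have h3 : (|t| + 2) ^ (-(1/4) : ℝ) ≤ (R + 2) ^ (-(1/4) : ℝ) :=
    Real.rpow_le_rpow_of_nonpos (by linarith) (by linarith) (by norm_num)
  have h4 : (|t| + 2) ^ (-(3/4) : ℝ) ≤ (1 + |t|) ^ (-(3/4) : ℝ) :=
    Real.rpow_le_rpow_of_nonpos (by linarith) (by linarith) (by norm_num)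
  rw [h2] at h1
  refine h1.trans ?_
  rw [mul_assoc]
  gcongr

lemma form_bound (a b : ℝ → ℂ) (hb : Continuous b) (hb_supp : HasCompactSupport b)
    (hb_var : eVariationOn b Set.univ ≠ ⊤) (A : ℝ) (hA : ∀ x, A < |x| → a x = 0)
    (haL : MemLp a 2 volume)
    (f φ : Lp ℂ 2 (volume : Measure ℝ)) (R : ℝ) (hR1 : 1 ≤ R) (hRA : 2 * A ≤ R) :
    ‖∫ p : ℝ × ℝ, ((Set.indicator {y : ℝ | R < |y|} (fun _ => (1 : ℂ)) p.1 * f p.1) *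
        (starRingEnd ℂ) ((starRingEnd ℂ) (a p.2) * φ p.2)) *
        ∫ y : ℝ, b y * Complex.exp (Complex.I * ((p.1 - p.2 : ℝ) : ℂ) * y)‖ ≤
      (12 * Real.pi * (eVariationOn b Set.univ).toReal * (R + 2) ^ (-(1/4) : ℝ)) *
        ((‖f‖ * ‖memLp_h.toLp‖) * (‖haL.toLp‖ * ‖φ‖)) := by
  set V := (eVariationOn b Set.univ).toReal with hVdef
  have hV : 0 ≤ V := ENNReal.toReal_nonneg
  obtain ⟨i1, c1⟩ := cs_aux f memLp_h.toLp
  obtain ⟨i2, c2⟩ := cs_aux haL.toLp φ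
  have e1 : (fun t => ‖f t‖ * ‖(memLp_h.toLp : ℝ → ℂ) t‖) =ᵐ[volume]
      fun t => ‖f t‖ * (1 + ‖t‖) ^ (-(3/4) : ℝ) := by
    filter_upwards [memLp_h.coeFn_toLp] with t ht
    rw [ht, Complex.norm_real, Real.norm_of_nonneg (r := (1 + ‖t‖) ^ (-(3/4) : ℝ)) (by positivity)]
  have e2 : (fun t => ‖(haL.toLp : ℝ → ℂ) t‖ * ‖φ t‖) =ᵐ[volume] fun t => ‖a t‖ * ‖φ t‖ := by
    filter_upwards [haL.coeFn_toLp] with t ht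
    rw [ht]
  rw [integral_congr_ae e1] at c1
  rw [integral_congr_ae e2] at c2
  have j1 := i1.congr e1
  have j2 := i2.congr e2
  have j := (j1.mul_prod j2).const_mul (12 * Real.pi * V * (R + 2) ^ (-(1/4) : ℝ))
  refine (norm_integral_le_of_norm_le j (Eventually.of_forall fun p => ?_)).trans ?_
  · obtain ⟨t, x⟩ := p
    simp only [norm_mul, RCLike.norm_conj]
    have hpi := Real.pi_pos
    have hR2 : 0 ≤ (R + 2) ^ (-(1/4) : ℝ) := Real.rpow_nonneg (by linarith) _
    by_cases ht : R < |t|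
    · by_cases hx : A < |x|
      · simp only [hA x hx, norm_zero]; simp
      · rw [Set.indicator_of_mem (by exact ht)]
        push Not at hx
        have htx : |t| ≤ 2 * |t - x| := by
          have := abs_sub_abs_le_abs_sub t x
          linarith
        have h0 : 0 < |t| := by linarith
        have hne : t - x ≠ 0 := by
          intro h; rw [h] at htx; simp at htx; simp [htx] at h0
        have hk := kernel_decay b hb hb_supp hb_var (t - x) hne
        rw [← hVdef] at hk
        have hk2 : 2 * V / |t - x| * Real.pi ≤ 4 * Real.pi * V * |t|⁻¹ := by
          have : |t - x|⁻¹ ≤ 2 * |t|⁻¹ := by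
            rw [← div_eq_mul_inv, inv_eq_one_div, div_le_div_iff₀ (abs_pos.mpr hne) h0]
            linarith
          calc 2 * V / |t - x| * Real.pi = (2 * V * Real.pi) * |t - x|⁻¹ := by ring
            _ ≤ (2 * V * Real.pi) * (2 * |t|⁻¹) := by gcongr
            _ = _ := by ring
        have hk3 := inv_aux R t hR1 ht
        have hk4 : ‖∫ y : ℝ, b y * Complex.exp (Complex.I * ((t - x : ℝ) : ℂ) * y)‖ ≤
            4 * Real.pi * V * (3 * (R + 2) ^ (-(1/4) : ℝ) * (1 + ‖t‖) ^ (-(3/4) : ℝ)) :=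
          hk.trans (hk2.trans (by gcongr))
        calc _ ≤ ‖(1:ℂ)‖ * ‖f t‖ * (‖a x‖ * ‖φ x‖) *
              (4 * Real.pi * V * (3 * (R + 2) ^ (-(1/4) : ℝ) * (1 + ‖t‖) ^ (-(3/4) : ℝ))) := by
              gcongr
          _ = _ := by rw [norm_one]; ring
    · rw [Set.indicator_of_notMem (by exact ht)]
      simp only [norm_zero, zero_mul]
      positivity
  · have hpi := Real.pi_pos
    have hR2 : 0 ≤ (R + 2) ^ (-(1/4) : ℝ) := Real.rpow_nonneg (by linarith) _
    rw [integral_const_mul]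
    gcongr
    have := integral_prod_mul (μ := (volume : Measure ℝ)) (ν := (volume : Measure ℝ))
      (fun t => ‖f t‖ * (1 + ‖t‖) ^ (-(3/4) : ℝ)) (fun x => ‖a x‖ * ‖φ x‖)
    refine this.le.trans ?_
    gcongr



/-- Let `a ∈ C_c(ℝ)` and let `b ∈ C_c(ℝ)` have bounded variation. Let `F` be the
Fourier–Plancherel transform on `L²(ℝ)` and `Ma`, `Mb` the multiplication operators by
`a` resp. `b`. Then for every `n ∈ ℕ` there is a constant `c = c_n(a,b) > 0` such that
for all `R > 0` the operator `f ↦ a · W⁰(b)(χ_{ℝ∖[-R,R]} f)` on `L²(ℝ)` has operator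
norm at most `c / log^n(R+2)`, where `W⁰(b) = F⁻¹ ∘ Mb ∘ F` and `Chi` is the operator
of multiplication by the characteristic function of `ℝ ∖ [-R, R]`. -/
theorem stmt9
    (a b : ℝ → ℂ) (ha : Continuous a) (ha_supp : HasCompactSupport a)
    (hb : Continuous b) (hb_supp : HasCompactSupport b)
    (hb_var : eVariationOn b Set.univ ≠ ⊤)
    (F : Lp ℂ 2 (volume : Measure ℝ) ≃L[ℂ] Lp ℂ 2 (volume : Measure ℝ))
    (hF : ∀ f : Lp ℂ 2 (volume : Measure ℝ), Integrable (f : ℝ → ℂ) →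
      (F f : ℝ → ℂ) =ᵐ[volume]
        fun x : ℝ => ∫ t : ℝ, f t * Complex.exp (Complex.I * (t : ℂ) * (x : ℂ)))
    (Ma Mb : Lp ℂ 2 (volume : Measure ℝ) →L[ℂ] Lp ℂ 2 (volume : Measure ℝ))
    (hMa : ∀ f : Lp ℂ 2 (volume : Measure ℝ),
      (Ma f : ℝ → ℂ) =ᵐ[volume] fun x => a x * f x)
    (hMb : ∀ f : Lp ℂ 2 (volume : Measure ℝ),
      (Mb f : ℝ → ℂ) =ᵐ[volume] fun x => b x * f x)
    (n : ℕ) :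
    ∃ c : ℝ, 0 < c ∧ ∀ R : ℝ, 0 < R →
      ∀ Chi : Lp ℂ 2 (volume : Measure ℝ) →L[ℂ] Lp ℂ 2 (volume : Measure ℝ),
        (∀ f : Lp ℂ 2 (volume : Measure ℝ),
          (Chi f : ℝ → ℂ) =ᵐ[volume]
            fun x => Set.indicator {y : ℝ | R < |y|} (fun _ => (1 : ℂ)) x * f x) →
        ‖Ma.comp
            ((F.symm : Lp ℂ 2 (volume : Measure ℝ) →L[ℂ] Lp ℂ 2 (volume : Measure ℝ)).comp
              (Mb.comp
                ((F : Lp ℂ 2 (volume : Measure ℝ) →L[ℂ] Lp ℂ 2 (volume : Measure ℝ)).comp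
                  Chi)))‖ ≤ c / (Real.log (R + 2)) ^ n := by
  obtain ⟨A, hA'⟩ := ha_supp.isCompact.isBounded.subset_closedBall 0
  have hA : ∀ x, A < |x| → a x = 0 := by
    intro x hx
    by_contra hne
    have := hA' (subset_tsupport a hne)
    simp at this; linarith
  have haL : MemLp a 2 volume := ha.memLp_of_hasCompactSupport ha_supp
  have hbI : Integrable b := hb.integrable_of_hasCompactSupport hb_supp
  set V := (eVariationOn b Set.univ).toReal with hVdef
  have hV : 0 ≤ V := ENNReal.toReal_nonneg
  set D : ℝ := 6 * V * ‖memLp_h.toLp‖ * ‖haL.toLp‖ with hD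
  have hD0 : 0 ≤ D := by positivity
  -- logarithm versus power
  have hlog : ∀ᶠ R : ℝ in atTop, (Real.log (R + 2)) ^ n ≤ (R + 2) ^ (1/4 : ℝ) := by
    have h1 := (isLittleO_log_rpow_rpow_atTop (n : ℝ) (s := 1/4) (by norm_num)).bound one_pos
    have h2 := (tendsto_atTop_add_const_right atTop (2:ℝ) tendsto_id).eventually h1
    filter_upwards [h2, eventually_ge_atTop 0] with R h3 hR
    simp only [id, Real.rpow_natCast, one_mul] at h3
    rw [Real.norm_of_nonneg (r := (R + 2) ^ (1/4 : ℝ)) (Real.rpow_nonneg (by linarith) _)] at h3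
    exact (le_abs_self _).trans h3
  obtain ⟨R1, hR1⟩ := eventually_atTop.mp hlog
  set R0 := max R1 (max 1 (2 * A))
  set N := ‖Ma‖ * (‖(F.symm : Lp ℂ 2 (volume : Measure ℝ) →L[ℂ] Lp ℂ 2 (volume : Measure ℝ))‖ *
    (‖Mb‖ * ‖(F : Lp ℂ 2 (volume : Measure ℝ) →L[ℂ] Lp ℂ 2 (volume : Measure ℝ))‖)) with hN
  have hN0 : 0 ≤ N := by positivity
  have hR01 : 1 ≤ R0 := (le_max_left _ _).trans (le_max_right _ _)
  have hlog0 : 0 ≤ Real.log (R0 + 2) := Real.log_nonneg (by linarith)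
  refine ⟨N * Real.log (R0 + 2) ^ n + D + 1, by positivity, ?_⟩
  intro R hR Chi hChi
  have hlogR : 0 < Real.log (R + 2) := Real.log_pos (by linarith)
  rw [le_div_iff₀ (by positivity)]
  rcases le_total R R0 with hle | hge
  · have hC : ‖Chi‖ ≤ 1 := by
      refine ContinuousLinearMap.opNorm_le_bound _ zero_le_one fun f => ?_
      rw [one_mul]
      apply Lp.norm_le_norm_of_ae_le
      filter_upwards [hChi f] with x hx
      rw [hx, norm_mul]
      by_cases h : x ∈ {y : ℝ | R < |y|}
      · rw [Set.indicator_of_mem h]; simp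
      · rw [Set.indicator_of_notMem h]; simp
    have hop : ‖Ma.comp
            ((F.symm : Lp ℂ 2 (volume : Measure ℝ) →L[ℂ] Lp ℂ 2 (volume : Measure ℝ)).comp
              (Mb.comp
                ((F : Lp ℂ 2 (volume : Measure ℝ) →L[ℂ] Lp ℂ 2 (volume : Measure ℝ)).comp
                  Chi)))‖ ≤ N := by
      refine (ContinuousLinearMap.opNorm_comp_le _ _).trans ?_
      rw [hN]
      gcongr
      refine (ContinuousLinearMap.opNorm_comp_le _ _).trans ?_
      gcongr
      refine (ContinuousLinearMap.opNorm_comp_le _ _).trans ?_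
      gcongr
      refine (ContinuousLinearMap.opNorm_comp_le _ _).trans ?_
      exact mul_le_of_le_one_right (norm_nonneg _) hC
    have hl : Real.log (R + 2) ^ n ≤ Real.log (R0 + 2) ^ n := by
      gcongr
    calc _ ≤ N * Real.log (R0 + 2) ^ n := by gcongr
      _ ≤ _ := by linarith
  · have hR1' : 1 ≤ R := hR01.trans hge
    have hRA : 2 * A ≤ R := ((le_max_right _ _).trans (le_max_right _ _)).trans hge
    have hRl := hR1 R ((le_max_left _ _).trans hge)
    have hpow : (R + 2) ^ (-(1/4) : ℝ) * (R + 2) ^ (1/4 : ℝ) = 1 := by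
      rw [← Real.rpow_add (by linarith)]; norm_num
    have hR2 : 0 ≤ (R + 2) ^ (-(1/4) : ℝ) := Real.rpow_nonneg (by linarith) _
    have hop : ‖Ma.comp
            ((F.symm : Lp ℂ 2 (volume : Measure ℝ) →L[ℂ] Lp ℂ 2 (volume : Measure ℝ)).comp
              (Mb.comp
                ((F : Lp ℂ 2 (volume : Measure ℝ) →L[ℂ] Lp ℂ 2 (volume : Measure ℝ)).comp
                  Chi)))‖ ≤ D * (R + 2) ^ (-(1/4) : ℝ) := by
      refine ContinuousLinearMap.opNorm_le_bound _ (by positivity) fun f => ?_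
      have hdense := SchwartzMap.denseRange_toLpCLM (E := ℝ) (F := ℂ) (p := 2) (μ := volume)
        ENNReal.ofNat_ne_top
      refine hdense.induction_on f ?_ ?_
      · apply isClosed_le <;> fun_prop
      intro u
      simp only [SchwartzMap.toLpCLM_apply]
      set f := u.toLp 2 volume with hf
      have hfI : Integrable f := u.integrable.congr (u.coeFn_toLp 2 volume).symm
      set g := Chi f with hg
      have hgI0 : Integrable
          (fun x => Set.indicator {y : ℝ | R < |y|} (fun _ => (1 : ℂ)) x * f x) := by
        refine hfI.bdd_mul (c := 1) ?_ ?_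
        · apply Measurable.aestronglyMeasurable
          apply Measurable.indicator measurable_const
          exact measurableSet_lt measurable_const (by fun_prop)
        · refine Eventually.of_forall fun x => ?_
          by_cases h : x ∈ {y : ℝ | R < |y|}
          · rw [Set.indicator_of_mem h]; simp
          · rw [Set.indicator_of_notMem h]; simp
      have hgI : Integrable g := hgI0.congr (hChi f).symm
      set w := F.symm (Mb (F g)) with hw
      set φ := Ma w with hφ
      change ‖φ‖ ≤ _
      have haB : ∃ C, ∀ x, ‖a x‖ ≤ C := ha.bounded_above_of_compact_support ha_supp
      obtain ⟨C, hC⟩ := haB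
      have hψL : MemLp (fun x => (starRingEnd ℂ) (a x) * φ x) 2 volume := by
        refine (Lp.memLp φ).of_le_mul (c := C) ?_ ?_
        · exact (Continuous.aestronglyMeasurable (by fun_prop)).mul (Lp.aestronglyMeasurable φ)
        · refine Eventually.of_forall fun x => ?_
          rw [norm_mul, RCLike.norm_conj]
          gcongr
          exact hC x
      have hψI0 : Integrable (fun x => (starRingEnd ℂ) (a x) * φ x) :=
        haL.star.integrable_mul (Lp.memLp φ)
      set ψ := hψL.toLp with hψ
      have hψe : (ψ : ℝ → ℂ) =ᵐ[volume] fun x => (starRingEnd ℂ) (a x) * φ x := hψL.coeFn_toLp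
      have hψI : Integrable ψ := hψI0.congr hψe.symm
      have k1 : inner ℂ φ φ = inner ℂ ψ w := by
        rw [L2.inner_def, L2.inner_def]
        apply integral_congr_ae
        filter_upwards [hψe, hMa w] with x h1 h2
        rw [h1, RCLike.inner_apply, RCLike.inner_apply]
        nth_rewrite 1 [hφ]
        rw [h2]
        simp only [map_mul, Complex.conj_conj]; ring
      have k2 : inner ℂ (F ψ) (F w) = 2 * Real.pi * inner ℂ φ φ := by
        rw [parseval F hF, k1]
      have k3 : inner ℂ (F ψ) (F w) = ∫ p : ℝ × ℝ,
          ((Set.indicator {y : ℝ | R < |y|} (fun _ => (1 : ℂ)) p.1 * f p.1) *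
          (starRingEnd ℂ) ((starRingEnd ℂ) (a p.2) * φ p.2)) *
          ∫ y : ℝ, b y * Complex.exp (Complex.I * ((p.1 - p.2 : ℝ) : ℂ) * y) := by
        rw [← triple b _ _ hbI hgI0 hψI0, hw, ContinuousLinearEquiv.apply_symm_apply, L2.inner_def]
        apply integral_congr_ae
        filter_upwards [hMb (F g), hF g hgI, hF ψ hψI] with y h1 h2 h3
        rw [h1, h2, h3, RCLike.inner_apply]
        congr 2
        · apply integral_congr_ae
          filter_upwards [hChi f] with t ht
          rw [hg, ht]
        · apply integral_congr_ae
          filter_upwards [hψe] with t ht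
          rw [ht]
      have k4 := form_bound a b hb hb_supp hb_var A hA haL f φ R hR1' hRA
      rw [← k3, k2, inner_self_eq_norm_sq_to_K, ← hVdef] at k4
      have hpi := Real.pi_pos
      simp only [norm_mul, norm_pow, Complex.norm_real, RCLike.norm_ofReal, abs_norm,
        Real.norm_of_nonneg hpi.le, RCLike.norm_ofNat] at k4
      rcases (norm_nonneg φ).eq_or_lt with h0 | h0
      · rw [← h0]; positivity
      · have : (2 * Real.pi * ‖φ‖) * ‖φ‖ ≤
            (2 * Real.pi * ‖φ‖) * (D * (R + 2) ^ (-(1/4) : ℝ) * ‖f‖) := by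
          rw [hD]
          calc _ = 2 * Real.pi * ‖φ‖ ^ 2 := by ring
            _ ≤ _ := k4
            _ = _ := by ring
        exact le_of_mul_le_mul_left this (by positivity)
    calc _ ≤ D * (R + 2) ^ (-(1/4) : ℝ) * (R + 2) ^ (1/4 : ℝ) := by gcongr
      _ = D := by rw [mul_assoc, hpow, mul_one]
      _ ≤ _ := by
        have : 0 ≤ N * Real.log (R0 + 2) ^ n := by positivity
        linarith
end
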